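/- Let R be a commutative ring that is complete and separated for the I-adic topology where I = (π) for a non-zero-divisor π, and let M be a finitely generated R-module with no π-torsion such that M/πM is flat over R/πR. Then M is flat over R. -/

import Mathlib

theorem Submodule.exists_eq_smul_of_mem_span_singleton_smul_top {R N : Type*} [CommRing R]
    [AddCommGroup N] [Module R N] {r : R} {x : N}
    (hx : x ∈ (Ideal.span {r} • ⊤ : Submodule R N)) : ∃ y, x = r • y := by
  rw [Submodule.ideal_span_singleton_smul] at hx
  obtain ⟨y, -, rfl⟩ := hx
  exact ⟨y, rfl⟩

/-- If `π` lies in the Jacobson radical and `h : F → K` is a retraction modulo `π` of the inclusion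
of a Noetherian submodule `K`, then this inclusion admits a retraction. -/
theorem Submodule.exists_retraction_of_sub_mem_smul {R F : Type*} [CommRing R] [AddCommGroup F]
    [Module R F] {π : R} (hjac : π ∈ (⊥ : Ideal R).jacobson) (K : Submodule R F)
    [IsNoetherian R K] (h : F →ₗ[R] K) (hK : ∀ k : K, ∃ x : K, k - h k = π • x) :
    ∃ r : F →ₗ[R] K, r ∘ₗ K.subtype = LinearMap.id := by
  have hsurj : Function.Surjective (h ∘ₗ K.subtype) := by
    rw [← LinearMap.range_eq_top, eq_top_iff]
    refine Submodule.le_of_le_smul_of_le_jacobson_bot (I := Ideal.span {π})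
      Module.Finite.fg_top ((Ideal.span_singleton_le_iff_mem _).2 hjac) fun k _ ↦ ?_
    obtain ⟨x, hx⟩ := hK k
    rw [← sub_add_cancel k (h k), hx, add_comm]
    exact Submodule.add_mem_sup ⟨k, rfl⟩
      (Submodule.smul_mem_smul (Ideal.mem_span_singleton_self π) Submodule.mem_top)
  let e := LinearEquiv.ofBijective _ (IsNoetherian.bijective_of_surjective_endomorphism _ hsurj)
  exact ⟨e.symm.toLinearMap ∘ₗ h, LinearMap.ext fun k ↦ e.symm_apply_apply k⟩

/-- A finitely generated module over a Noetherian ring on which an element `π` of the Jacobson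
radical acts injectively is projective as soon as its reduction modulo `π` is projective. -/
theorem Module.projective_of_projective_quotient_smul_top {R M : Type*} [CommRing R]
    [IsNoetherianRing R] [AddCommGroup M] [Module R M] [Module.Finite R M] {π : R}
    (hjac : π ∈ (⊥ : Ideal R).jacobson) (htf : ∀ m : M, π • m = 0 → m = 0)
    [Module.Projective (R ⧸ Ideal.span {π}) (M ⧸ (Ideal.span {π} • ⊤ : Submodule R M))] :
    Module.Projective R M := by
  obtain ⟨n, p, hp⟩ := Module.Finite.exists_fin' R M
  set I : Ideal R := Ideal.span {π}
  let q₀ : ((Fin n → R) ⧸ (I • ⊤ : Submodule R (Fin n → R))) →ₗ[R]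
      (M ⧸ (I • ⊤ : Submodule R M)) :=
    Submodule.mapQ _ _ p (by
      rw [← Submodule.map_le_iff_le_comap, Submodule.map_smul'']
      exact Submodule.smul_mono le_rfl le_top)
  let q := q₀.extendScalarsOfSurjective (S := R ⧸ I) Ideal.Quotient.mk_surjective
  have hq : Function.Surjective q := by
    intro y
    obtain ⟨m, rfl⟩ := Submodule.mkQ_surjective _ y
    obtain ⟨x, rfl⟩ := hp m
    exact ⟨Submodule.mkQ _ x, rfl⟩
  obtain ⟨s, hs⟩ := Module.projective_lifting_property q LinearMap.id hq
  obtain ⟨σ, hσ⟩ := Module.projective_lifting_property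
    (I • ⊤ : Submodule R (Fin n → R)).mkQ
    (s.restrictScalars R ∘ₗ (I • ⊤ : Submodule R M).mkQ ∘ₗ p) (Submodule.mkQ_surjective _)
  have hpσ (x : Fin n → R) : p (x - σ x) ∈ (I • ⊤ : Submodule R M) := by
    rw [← Submodule.Quotient.mk_eq_zero, map_sub, Submodule.Quotient.mk_sub, sub_eq_zero]
    have h₁ : (I • ⊤ : Submodule R (Fin n → R)).mkQ (σ x) = s (Submodule.Quotient.mk (p x)) :=
      LinearMap.congr_fun hσ x
    have h₂ : q (s (Submodule.Quotient.mk (p x))) = Submodule.Quotient.mk (p x) :=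
      LinearMap.congr_fun hs _
    rw [← h₂, ← h₁]
    rfl
  have hmem (x : Fin n → R) : p (x - σ x) ∈ LinearMap.range (π • p) := by
    obtain ⟨m, hm⟩ := Submodule.exists_eq_smul_of_mem_span_singleton_smul_top (hpσ x)
    obtain ⟨y, rfl⟩ := hp m
    exact ⟨y, hm.symm⟩
  obtain ⟨τ, hτ⟩ := Module.projective_lifting_property (π • p).rangeRestrict
    ((p ∘ₗ (LinearMap.id - σ)).codRestrict _ hmem) (π • p).surjective_rangeRestrict
  have hτ' (x : Fin n → R) : π • p (τ x) = p (x - σ x) :=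
    congrArg Subtype.val (LinearMap.congr_fun hτ x)
  let h : (Fin n → R) →ₗ[R] LinearMap.ker p :=
    (LinearMap.id - σ - π • τ).codRestrict _ fun x ↦ by
      simpa [sub_eq_zero] using (hτ' x).symm
  have hK (k : LinearMap.ker p) : ∃ x : LinearMap.ker p, k - h k = π • x := by
    have hσk : σ k ∈ (I • ⊤ : Submodule R (Fin n → R)) := by
      rw [← Submodule.Quotient.mk_eq_zero]
      refine (LinearMap.congr_fun hσ k).trans ?_
      simp [LinearMap.mem_ker.1 k.2]
    obtain ⟨y, hy⟩ := Submodule.exists_eq_smul_of_mem_span_singleton_smul_top hσk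
    have hk : (k : Fin n → R) - h k = π • (y + τ k) := by
      simp only [h, LinearMap.codRestrict_apply, LinearMap.sub_apply, LinearMap.id_apply,
        LinearMap.smul_apply, hy, smul_add]
      abel
    refine ⟨⟨y + τ k, htf _ ?_⟩, Subtype.ext hk⟩
    rw [← map_smul, ← hk, map_sub, LinearMap.mem_ker.1 k.2, LinearMap.mem_ker.1 (h k).2, sub_zero]
  obtain ⟨r, hr⟩ := Submodule.exists_retraction_of_sub_mem_smul hjac _ h hK
  have hsplit : (∃ i, p ∘ₗ i = LinearMap.id) ↔
      ∃ r : (Fin n → R) →ₗ[R] LinearMap.ker p, r ∘ₗ (LinearMap.ker p).subtype = LinearMap.id :=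
    ((LinearMap.exact_subtype_ker_map p).split_tfae (Submodule.subtype_injective _) hp).out 0 1
  obtain ⟨i, hi⟩ := hsplit.2 ⟨r, hr⟩
  exact Module.Projective.of_split i p hi

theorem flat_of_complete_of_flat_mod_pi
    (R : Type*) [CommRing R] [IsNoetherianRing R] (π : R)
    (hπ : π ∈ nonZeroDivisors R)
    (hcomplete : IsAdicComplete (Ideal.span {π}) R)
    (M : Type*) [AddCommGroup M] [Module R M] [Module.Finite R M]
    (htf : ∀ m : M, π • m = 0 → m = 0)
    (hflat : Module.Flat (R ⧸ Ideal.span {π})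
      (M ⧸ (Ideal.span {π} • ⊤ : Submodule R M))) :
    Module.Flat R M := by
  have := Module.finitePresentation_of_finite (R ⧸ Ideal.span {π})
    (M ⧸ (Ideal.span {π} • ⊤ : Submodule R M))
  have := Module.Flat.projective_of_finitePresentation (R := R ⧸ Ideal.span {π})
    (M := M ⧸ (Ideal.span {π} • ⊤ : Submodule R M))
  have := Module.projective_of_projective_quotient_smul_top
    (IsAdicComplete.le_jacobson_bot (Ideal.span {π}) (Ideal.mem_span_singleton_self π)) htf
  infer_instance
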